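/- Fix integers a ≥ 2, d ≥ 1, N ≥ 1 and L ≥ 1 with N·L ≤ a^d. Then there exists a configuration of N polymers of length L on the d-dimensional torus of side a, i.e., N self-avoiding paths of length L whose vertex images are pairwise disjoint. -/

import Mathlib

/-- Two vertices of the `d`-dimensional torus of side `a` are adjacent iff they agree in all
but exactly one coordinate, in which they differ by `+1` or `-1` in `ZMod a`. -/
def torusAdj (a d : ℕ) (u v : Fin d → ZMod a) : Prop :=
  ∃ i : Fin d, (∀ j, j ≠ i → u j = v j) ∧ (v i = u i + 1 ∨ v i = u i - 1)

/-- A self-avoiding path of length `L` on the `d`-dimensional torus of side `a`. -/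
structure SAPath (a d L : ℕ) where
  toFun : Fin L → (Fin d → ZMod a)
  inj : Function.Injective toFun
  adj : ∀ i : ℕ, ∀ h : i + 1 < L,
    torusAdj a d (toFun ⟨i, Nat.lt_of_succ_lt h⟩) (toFun ⟨i + 1, h⟩)

/-- Two self-avoiding paths are identified if one is the reversal of the other. -/
def pathRel {a d L : ℕ} (p q : SAPath a d L) : Prop :=
  q.toFun = p.toFun ∨ q.toFun = p.toFun ∘ Fin.rev

instance polymerSetoid (a d L : ℕ) : Setoid (SAPath a d L) where
  r := pathRel
  iseqv := by
    constructor
    · intro p; exact Or.inl rfl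
    · intro p q h
      rcases h with h | h
      · exact Or.inl h.symm
      · refine Or.inr ?_
        rw [h]
        funext i
        simp [Function.comp, Fin.rev_rev]
    · intro p q r h1 h2
      rcases h1 with h1 | h1 <;> rcases h2 with h2 | h2
      · exact Or.inl (h2.trans h1)
      · exact Or.inr (by rw [h2, h1])
      · exact Or.inr (by rw [h2, h1])
      · refine Or.inl ?_
        rw [h2, h1]
        funext i
        simp [Function.comp, Fin.rev_rev]

/-- A polymer: a self-avoiding path up to reversal. -/
def Polymer (a d L : ℕ) := Quotient (polymerSetoid a d L)

noncomputable instance (a d L : ℕ) : DecidableEq (Polymer a d L) := Classical.decEq _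

/-- The support of a polymer: the set of vertices it occupies. -/
def Polymer.support {a d L : ℕ} : Polymer a d L → Set (Fin d → ZMod a) :=
  Quotient.lift (fun p => Set.range p.toFun) (by
    intro p q h
    rcases h with h | h
    · show Set.range p.toFun = Set.range q.toFun
      rw [h]
    · show Set.range p.toFun = Set.range q.toFun
      rw [h]
      exact ((Fin.rev_involutive).surjective.range_comp p.toFun).symm)

/-- A configuration of `N` polymers of length `L` on the `d`-dimensional torus of side `a`:
`N` self-avoiding paths (up to reversal) with pairwise disjoint supports. -/
structure Config (a d L N : ℕ) where
  polymers : Finset (Polymer a d L)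
  card_eq : polymers.card = N
  disj : ∀ P ∈ polymers, ∀ Q ∈ polymers, P ≠ Q →
    Disjoint (Polymer.support P) (Polymer.support Q)

/-- The configuration graph: two configurations are adjacent iff they are distinct and their
intersection contains exactly `N - 1` polymers. -/
noncomputable def configGraph (a d L N : ℕ) : SimpleGraph (Config a d L N) where
  Adj S S' := S ≠ S' ∧ (S.polymers ∩ S'.polymers).card = N - 1
  symm := by
    refine ⟨?_⟩
    intro S S' h
    exact ⟨h.1.symm, by rw [Finset.inter_comm]; exact h.2⟩
  loopless := by refine ⟨?_⟩; intro S h; exact h.1 rfl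

/-- modular Gray code -/
def grayVert (a d n : ℕ) : Fin d → ZMod a :=
  fun i => ((n / a ^ (i : ℕ) : ℕ) : ZMod a) - ((n / a ^ ((i : ℕ) + 1) : ℕ) : ZMod a)

theorem grayVert_inj (a d n m : ℕ) (ha : 2 ≤ a) (hn : n < a ^ d) (hm : m < a ^ d)
    (h : grayVert a d n = grayVert a d m) : n = m := by
  have key : ∀ j, j ≤ d → n / a ^ (d - j) = m / a ^ (d - j) := by
    intro j
    induction j with
    | zero => intro _; simp [Nat.div_eq_of_lt hn, Nat.div_eq_of_lt hm]
    | succ j ih =>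
      intro hj
      have ih := ih (by omega)
      have h1 := congrFun h ⟨d - (j + 1), by omega⟩
      have e : d - (j + 1) + 1 = d - j := by omega
      simp only [grayVert, e, ih] at h1
      have h2 := sub_left_injective h1
      have h3 := (ZMod.natCast_eq_natCast_iff' _ _ _).1 h2
      rw [← e, pow_succ, ← Nat.div_div_eq_div_mul, ← Nat.div_div_eq_div_mul] at ih
      rw [← Nat.div_add_mod (n / a ^ (d - (j + 1))) a, ih, h3, Nat.div_add_mod]
  simpa using key d le_rfl

theorem grayVert_adj (a d n : ℕ) (ha : 2 ≤ a) (hn : n + 1 < a ^ d) :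
    torusAdj a d (grayVert a d n) (grayVert a d (n + 1)) := by
  have hex : ∃ k, ¬ a ^ (k + 1) ∣ n + 1 := by
    refine ⟨n + 1, fun hd => ?_⟩
    have h1 := Nat.le_of_dvd (by omega) hd
    have h2 : n + 1 + 1 < a ^ (n + 1 + 1) := Nat.lt_pow_self (by omega)
    omega
  classical
  obtain ⟨k, hk, hmin⟩ : ∃ k, ¬ a ^ (k + 1) ∣ n + 1 ∧ ∀ j < k, a ^ (j + 1) ∣ n + 1 :=
    ⟨Nat.find hex, Nat.find_spec hex, fun j hj => not_not.1 (Nat.find_min hex hj)⟩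
  have hle : ∀ j ≤ k, a ^ j ∣ n + 1 := by
    intro j hj
    cases j with
    | zero => simp
    | succ j => exact hmin j (by omega)
  have hgt : ∀ j, k < j → ¬ a ^ j ∣ n + 1 := fun j hj hdv =>
    hk ((pow_dvd_pow a hj).trans hdv)
  have hkd : k < d := by
    by_contra hc
    have := Nat.le_of_dvd (by omega) (hle d (by omega))
    omega
  refine ⟨⟨k, hkd⟩, ?_, Or.inl ?_⟩
  · intro j hj
    have hj' : (j : ℕ) ≠ k := fun e => hj (Fin.ext e)
    simp only [grayVert, Nat.succ_div]
    rcases lt_or_gt_of_ne hj' with h | h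
    · rw [if_pos (hle _ h.le), if_pos (hle _ h)]; push_cast; ring
    · rw [if_neg (hgt _ h), if_neg (hgt _ (by omega))]; simp
  · simp only [grayVert, Nat.succ_div]
    rw [if_pos (hle _ le_rfl), if_neg hk]; push_cast; ring

theorem config_nonempty (a d L N : ℕ) (ha : 2 ≤ a) (hd : 1 ≤ d) (hN : 1 ≤ N) (hL : 1 ≤ L)
    (hdens : N * L ≤ a ^ d) :
    Nonempty (Config a d L N) := by
  have hb : ∀ (k : Fin N) (i : ℕ), i < L → k * L + i < a ^ d := by
    intro k i hi
    have h1 : ((k : ℕ) + 1) * L ≤ N * L := Nat.mul_le_mul_right _ k.2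
    rw [Nat.add_mul] at h1
    omega
  let P : Fin N → SAPath a d L := fun k =>
    { toFun := fun i => grayVert a d (k * L + i)
      inj := fun i j h => by
        have := grayVert_inj a d _ _ ha (hb k i i.2) (hb k j j.2) h
        exact Fin.ext (by omega)
      adj := fun i h => grayVert_adj a d (k * L + i) ha (hb k (i + 1) h) }
  let Q : Fin N → Polymer a d L := fun k => Quotient.mk _ (P k)
  have hdisj : ∀ k l, k ≠ l → Disjoint (Polymer.support (Q k)) (Polymer.support (Q l)) := by
    intro k l hkl
    show Disjoint (Set.range (P k).toFun) (Set.range (P l).toFun)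
    rw [Set.disjoint_left]
    rintro _ ⟨i, rfl⟩ ⟨j, hj⟩
    have h := grayVert_inj a d _ _ ha (hb l j j.2) (hb k i i.2) hj
    apply hkl
    have h1 := congrArg (· / L) h
    simp only [Nat.mul_comm _ L, Nat.mul_add_div hL, Nat.div_eq_of_lt i.2,
      Nat.div_eq_of_lt j.2] at h1
    exact Fin.ext (by omega)
  have hinj : Function.Injective Q := by
    intro k l h
    by_contra hkl
    have h1 := hdisj k l hkl
    rw [h, disjoint_self] at h1
    have h2 : (P l).toFun ⟨0, hL⟩ ∈ Polymer.support (Q l) := ⟨⟨0, hL⟩, rfl⟩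
    rw [h1] at h2
    exact h2
  refine ⟨⟨Finset.univ.image Q, ?_, ?_⟩⟩
  · rw [Finset.card_image_of_injective _ hinj]; simp
  · intro p hp q hq hpq
    obtain ⟨k, -, rfl⟩ := Finset.mem_image.1 hp
    obtain ⟨l, -, rfl⟩ := Finset.mem_image.1 hq
    exact hdisj k l (fun e => hpq (by rw [e]))
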